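/- For t ∈ (0,1) assume ∂₂²f(0,t) + 1/(2t) > 0 and set W(t) = 2·∂₁∂₂f(0,t) / (∂₂²f(0,t) + 1/(2t)). Then for every x₂ ∈ (0,1), lim_{x₁→0⁺} ∂₁∂₂(u¹²)(x₁,x₂) = −W'(x₂). -/

import Mathlib

open Real Filter Set Topology

/-- First partial derivative of a function of two real variables. -/
noncomputable def pd1 (g : ℝ → ℝ → ℝ) : ℝ → ℝ → ℝ := fun x y => deriv (fun s => g s y) x

/-- Second partial derivative of a function of two real variables. -/
noncomputable def pd2 (g : ℝ → ℝ → ℝ) : ℝ → ℝ → ℝ := fun x y => deriv (fun s => g x s) y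

/-- The symplectic potential in Guillemin normal form near a corner:
`u(x₁,x₂) = (1/2)(x₁ log x₁ + x₂ log x₂) + f(x₁,x₂)`. -/
noncomputable def upot (f : ℝ → ℝ → ℝ) : ℝ → ℝ → ℝ :=
  fun x y => 1 / 2 * (x * Real.log x + y * Real.log y) + f x y

/-- Determinant `D = u₁₁ u₂₂ − u₁₂²` of the Hessian of `u`. -/
noncomputable def hessDet (f : ℝ → ℝ → ℝ) : ℝ → ℝ → ℝ :=
  fun x y => pd1 (pd1 (upot f)) x y * pd2 (pd2 (upot f)) x y - (pd1 (pd2 (upot f)) x y) ^ 2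

/-- Entry `u¹¹ = u₂₂ / D` of the inverse Hessian of `u`. -/
noncomputable def uInv11 (f : ℝ → ℝ → ℝ) : ℝ → ℝ → ℝ :=
  fun x y => pd2 (pd2 (upot f)) x y / hessDet f x y

/-- Entry `u¹² = u²¹ = −u₁₂ / D` of the inverse Hessian of `u`. -/
noncomputable def uInv12 (f : ℝ → ℝ → ℝ) : ℝ → ℝ → ℝ :=
  fun x y => -(pd1 (pd2 (upot f)) x y) / hessDet f x y

/-- Entry `u²² = u₁₁ / D` of the inverse Hessian of `u`. -/
noncomputable def uInv22 (f : ℝ → ℝ → ℝ) : ℝ → ℝ → ℝ :=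
  fun x y => pd1 (pd1 (upot f)) x y / hessDet f x y

theorem pd1_eq_fderiv {g : ℝ → ℝ → ℝ} {x y : ℝ}
    (h : DifferentiableAt ℝ (Function.uncurry g) (x, y)) :
    pd1 g x y = fderiv ℝ (Function.uncurry g) (x, y) (1, 0) :=
  (h.hasFDerivAt.comp_hasDerivAt (f := fun s : ℝ => (s, y)) x
    ((hasDerivAt_id' x).prodMk (hasDerivAt_const x y))).deriv

theorem pd2_eq_fderiv {g : ℝ → ℝ → ℝ} {x y : ℝ}
    (h : DifferentiableAt ℝ (Function.uncurry g) (x, y)) :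
    pd2 g x y = fderiv ℝ (Function.uncurry g) (x, y) (0, 1) :=
  (h.hasFDerivAt.comp_hasDerivAt (f := fun s : ℝ => (x, s)) y
    ((hasDerivAt_const y x).prodMk (hasDerivAt_id' y))).deriv

theorem contDiff_pd1 {g : ℝ → ℝ → ℝ} (hg : ContDiff ℝ (⊤ : ℕ∞) (Function.uncurry g)) :
    ContDiff ℝ (⊤ : ℕ∞) (Function.uncurry (pd1 g)) := by
  have h : Function.uncurry (pd1 g) = fun p => fderiv ℝ (Function.uncurry g) p (1, 0) := by
    ext ⟨x, y⟩
    exact pd1_eq_fderiv (hg.differentiable (by simp) _)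
  rw [h]
  exact (hg.fderiv_right (by simp)).clm_apply contDiff_const

theorem contDiff_pd2 {g : ℝ → ℝ → ℝ} (hg : ContDiff ℝ (⊤ : ℕ∞) (Function.uncurry g)) :
    ContDiff ℝ (⊤ : ℕ∞) (Function.uncurry (pd2 g)) := by
  have h : Function.uncurry (pd2 g) = fun p => fderiv ℝ (Function.uncurry g) p (0, 1) := by
    ext ⟨x, y⟩
    exact pd2_eq_fderiv (hg.differentiable (by simp) _)
  rw [h]
  exact (hg.fderiv_right (by simp)).clm_apply contDiff_const

theorem differentiable_slice_left {g : ℝ → ℝ → ℝ}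
    (hg : ContDiff ℝ (⊤ : ℕ∞) (Function.uncurry g)) (y : ℝ) :
    Differentiable ℝ fun s => g s y :=
  (hg.differentiable (by simp)).comp
    (g := Function.uncurry g) (f := fun s : ℝ => (s, y)) (by fun_prop)

theorem differentiable_slice_right {g : ℝ → ℝ → ℝ}
    (hg : ContDiff ℝ (⊤ : ℕ∞) (Function.uncurry g)) (x : ℝ) :
    Differentiable ℝ fun s => g x s :=
  (hg.differentiable (by simp)).comp
    (g := Function.uncurry g) (f := fun s : ℝ => (x, s)) (by fun_prop)

theorem hasDerivAt_half_mul_log_add (c : ℝ) {h : ℝ → ℝ} {x : ℝ} (hx : 0 < x)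
    (hh : DifferentiableAt ℝ h x) :
    HasDerivAt (fun s => 1 / 2 * (s * Real.log s + c) + h s)
      (1 / 2 * (Real.log x + 1) + deriv h x) x :=
  (((Real.hasDerivAt_mul_log hx.ne').add_const c).const_mul (1 / 2)).add hh.hasDerivAt

theorem deriv_half_log_add_one_add {h : ℝ → ℝ} {x : ℝ} (hx : 0 < x)
    (hh : DifferentiableAt ℝ h x) :
    deriv (fun s => 1 / 2 * (Real.log s + 1) + h s) x = 1 / (2 * x) + deriv h x := by
  refine ((((Real.hasDerivAt_log hx.ne').add_const 1).const_mul (1 / 2)).add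
    hh.hasDerivAt).deriv.trans ?_
  field_simp

theorem pd1_upot {f : ℝ → ℝ → ℝ} (hf : ContDiff ℝ (⊤ : ℕ∞) (Function.uncurry f))
    {x : ℝ} (hx : 0 < x) (y : ℝ) :
    pd1 (upot f) x y = 1 / 2 * (Real.log x + 1) + pd1 f x y :=
  (hasDerivAt_half_mul_log_add _ hx (differentiable_slice_left hf y x)).deriv

theorem pd2_upot {f : ℝ → ℝ → ℝ} (hf : ContDiff ℝ (⊤ : ℕ∞) (Function.uncurry f))
    (x : ℝ) {y : ℝ} (hy : 0 < y) :
    pd2 (upot f) x y = 1 / 2 * (Real.log y + 1) + pd2 f x y := by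
  have h := hasDerivAt_half_mul_log_add (x * Real.log x) hy (differentiable_slice_right hf x y)
  simp only [add_comm _ (x * Real.log x)] at h
  exact h.deriv

theorem pd1_pd1_upot {f : ℝ → ℝ → ℝ} (hf : ContDiff ℝ (⊤ : ℕ∞) (Function.uncurry f))
    {x : ℝ} (hx : 0 < x) (y : ℝ) :
    pd1 (pd1 (upot f)) x y = 1 / (2 * x) + pd1 (pd1 f) x y := by
  have h : (fun s => pd1 (upot f) s y) =ᶠ[𝓝 x]
      fun s => 1 / 2 * (Real.log s + 1) + pd1 f s y := by
    filter_upwards [lt_mem_nhds hx] with s hs using pd1_upot hf hs y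
  exact h.deriv_eq.trans
    (deriv_half_log_add_one_add hx (differentiable_slice_left (contDiff_pd1 hf) y x))

theorem pd2_pd2_upot {f : ℝ → ℝ → ℝ} (hf : ContDiff ℝ (⊤ : ℕ∞) (Function.uncurry f))
    (x : ℝ) {y : ℝ} (hy : 0 < y) :
    pd2 (pd2 (upot f)) x y = 1 / (2 * y) + pd2 (pd2 f) x y := by
  have h : (fun s => pd2 (upot f) x s) =ᶠ[𝓝 y]
      fun s => 1 / 2 * (Real.log s + 1) + pd2 f x s := by
    filter_upwards [lt_mem_nhds hy] with s hs using pd2_upot hf x hs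
  exact h.deriv_eq.trans
    (deriv_half_log_add_one_add hy (differentiable_slice_right (contDiff_pd2 hf) x y))

theorem pd1_pd2_upot {f : ℝ → ℝ → ℝ} (hf : ContDiff ℝ (⊤ : ℕ∞) (Function.uncurry f))
    (x : ℝ) {y : ℝ} (hy : 0 < y) :
    pd1 (pd2 (upot f)) x y = pd1 (pd2 f) x y := by
  have h : (fun s => pd2 (upot f) s y) = fun s => 1 / 2 * (Real.log y + 1) + pd2 f s y :=
    funext fun s => pd2_upot hf s hy
  simp only [pd1, h, deriv_const_add]

/-- The factor `2 x D`, written in a form that is smooth up to the edge `x = 0`. -/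
noncomputable def edgeDet (f : ℝ → ℝ → ℝ) (x y : ℝ) : ℝ :=
  (1 + 2 * x * pd1 (pd1 f) x y) * (pd2 (pd2 f) x y + 1 / (2 * y)) -
    2 * x * pd1 (pd2 f) x y ^ 2

/-- The quotient `u¹² / x`, extended smoothly across the edge `x = 0`. -/
noncomputable def edgeQuot (f : ℝ → ℝ → ℝ) (x y : ℝ) : ℝ :=
  -(2 * pd1 (pd2 f) x y / edgeDet f x y)

theorem uInv12_eq_mul_edgeQuot {f : ℝ → ℝ → ℝ}
    (hf : ContDiff ℝ (⊤ : ℕ∞) (Function.uncurry f)) {x y : ℝ} (hx : 0 < x) (hy : 0 < y) :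
    uInv12 f x y = x * edgeQuot f x y := by
  have h : edgeDet f x y = 2 * x * hessDet f x y := by
    simp only [edgeDet, hessDet, pd1_pd1_upot hf hx, pd2_pd2_upot hf x hy, pd1_pd2_upot hf x hy]
    field_simp
    ring
  rw [uInv12, edgeQuot, h, pd1_pd2_upot hf x hy]
  field_simp

theorem contDiffAt_edgeQuot {f : ℝ → ℝ → ℝ}
    (hf : ContDiff ℝ (⊤ : ℕ∞) (Function.uncurry f)) {x y : ℝ} (hy : y ≠ 0)
    (hD : edgeDet f x y ≠ 0) :
    ContDiffAt ℝ 2 (Function.uncurry (edgeQuot f)) (x, y) := by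
  have h2 : (2 : WithTop ℕ∞) ≤ ((⊤ : ℕ∞) : WithTop ℕ∞) := WithTop.coe_le_coe.2 le_top
  have h11 := ((contDiff_pd1 (contDiff_pd1 hf)).of_le
    h2).contDiffAt (x := (x, y))
  have h22 := ((contDiff_pd2 (contDiff_pd2 hf)).of_le
    h2).contDiffAt (x := (x, y))
  have h12 := ((contDiff_pd1 (contDiff_pd2 hf)).of_le
    h2).contDiffAt (x := (x, y))
  have hx : ContDiffAt ℝ 2 (fun p : ℝ × ℝ => 2 * p.1) (x, y) :=
    contDiffAt_const.mul contDiffAt_fst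
  have hinv : ContDiffAt ℝ 2 (fun p : ℝ × ℝ => 1 / (2 * p.2)) (x, y) :=
    contDiffAt_const.div (contDiffAt_const.mul contDiffAt_snd) (by simpa using hy)
  have hE : ContDiffAt ℝ 2 (Function.uncurry (edgeDet f)) (x, y) :=
    ((contDiffAt_const.add (hx.mul h11)).mul (h22.add hinv)).sub (hx.mul (h12.pow 2))
  exact ((contDiffAt_const.mul h12).div hE hD).neg

theorem tendsto_pd1_pd2_of_eq_mul {g h : ℝ → ℝ → ℝ} {b : ℝ} (hb : 0 < b)
    (hh : ContDiffAt ℝ 2 (Function.uncurry h) (0, b))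
    (hg : ∀ x y, 0 < x → 0 < y → g x y = x * h x y) :
    Tendsto (fun x => pd1 (pd2 g) x b) (𝓝[>] 0) (𝓝 (pd2 h 0 b)) := by
  let K : ℝ × ℝ → ℝ := fun p => fderiv ℝ (Function.uncurry h) p (0, 1)
  have hKp : ContDiffAt ℝ 1 K (0, b) :=
    (hh.fderiv_right (m := 1) (by norm_num)).clm_apply contDiffAt_const
  have hline : Tendsto (fun x : ℝ => (x, b)) (𝓝[>] 0) (𝓝 (0, b)) :=
    ((by fun_prop : Continuous fun x : ℝ => (x, b)).tendsto 0).mono_left nhdsWithin_le_nhds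
  have hpd2 : ∀ᶠ p : ℝ × ℝ in 𝓝 (0, b), 0 < p.1 → pd2 g p.1 p.2 = p.1 * K p := by
    filter_upwards [hh.eventually (by simp), continuousAt_snd.eventually (lt_mem_nhds hb)]
      with ⟨x, y⟩ hxy hy hx
    have hev : (fun s => g x s) =ᶠ[𝓝 y] fun s => x * h x s := by
      filter_upwards [lt_mem_nhds hy] with s hs using hg x s hx hs
    have hd := hxy.differentiableAt (by simp)
    have hKxy : K (x, y) = pd2 h x y := (pd2_eq_fderiv hd).symm
    rw [hKxy]
    exact hev.deriv_eq.trans (deriv_const_mul_field x)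
  have hev : ∀ᶠ x in 𝓝[>] (0 : ℝ), pd1 (pd2 g) x b = K (x, b) + x * fderiv ℝ K (x, b) (1, 0) := by
    filter_upwards [hline.eventually (eventually_eventually_nhds.2 hpd2),
      hline.eventually (hKp.eventually (by simp)), self_mem_nhdsWithin] with x hx hKx hx0
    have hloc : (fun s => pd2 g s b) =ᶠ[𝓝 x] fun s => s * K (s, b) := by
      filter_upwards [((by fun_prop : Continuous fun s : ℝ => (s, b)).tendsto x).eventually hx,
        lt_mem_nhds hx0] with s hs hs0 using hs hs0
    have hKd : HasDerivAt (fun s => K (s, b)) (fderiv ℝ K (x, b) (1, 0)) x :=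
      (hKx.differentiableAt (by simp)).hasFDerivAt.comp_hasDerivAt
        (f := fun s : ℝ => (s, b)) x ((hasDerivAt_id' x).prodMk (hasDerivAt_const x b))
    refine hloc.deriv_eq.trans (((hasDerivAt_id x).mul hKd).deriv.trans ?_)
    simp
  rw [tendsto_congr' hev, pd2_eq_fderiv (hh.differentiableAt (by simp))]
  have hdK : ContinuousAt (fun p => fderiv ℝ K p (1, 0)) (0, b) :=
    ((hKp.fderiv_right (m := 0) (by norm_num)).clm_apply contDiffAt_const).continuousAt
  have hlim := (hKp.continuousAt.tendsto.comp hline).add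
    ((tendsto_id.mono_left (nhdsWithin_le_nhds (a := (0 : ℝ)) (s := Ioi 0))).mul
      (hdK.tendsto.comp hline))
  simpa using hlim

/-- For `t ∈ (0,1)` with `∂₂²f(0,t) + 1/(2t) > 0` set
`W(t) = 2 ∂₁∂₂f(0,t) / (∂₂²f(0,t) + 1/(2t))`.  Then for every `x₂ ∈ (0,1)`,
`lim_{x₁→0⁺} ∂₁∂₂(u¹²)(x₁,x₂) = −W'(x₂)`. -/
theorem stmt11 (f : ℝ → ℝ → ℝ) (hf : ContDiff ℝ (⊤ : ℕ∞) (Function.uncurry f))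
    (hpos : ∀ x ∈ Ioo (0:ℝ) 1, ∀ y ∈ Ioo (0:ℝ) 1,
      0 < hessDet f x y ∧ 0 < pd1 (pd1 (upot f)) x y)
    (hb : ∀ t ∈ Ioo (0:ℝ) 1, 0 < pd2 (pd2 f) 0 t + 1 / (2 * t))
    (W : ℝ → ℝ)
    (hW : ∀ t ∈ Ioo (0:ℝ) 1,
      W t = 2 * pd1 (pd2 f) 0 t / (pd2 (pd2 f) 0 t + 1 / (2 * t))) :
    ∀ x₂ ∈ Ioo (0:ℝ) 1,
      Tendsto (fun x₁ => pd1 (pd2 (uInv12 f)) x₁ x₂) (𝓝[>] 0) (𝓝 (-(deriv W x₂))) := by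
  intro b hb0
  have hE : ∀ t, edgeDet f 0 t = pd2 (pd2 f) 0 t + 1 / (2 * t) := fun t => by simp [edgeDet]
  have hquot : (fun t => edgeQuot f 0 t) =ᶠ[𝓝 b] fun t => -W t := by
    filter_upwards [Ioo_mem_nhds hb0.1 hb0.2] with t ht
    rw [edgeQuot, hE, hW t ht]
  have hlim := tendsto_pd1_pd2_of_eq_mul hb0.1
    (contDiffAt_edgeQuot hf hb0.1.ne' (by rw [hE]; exact (hb b hb0).ne'))
    fun x y hx hy => uInv12_eq_mul_edgeQuot hf hx hy
  have hderiv : pd2 (edgeQuot f) 0 b = -deriv W b := hquot.deriv_eq.trans deriv.fun_neg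
  rwa [hderiv] at hlim
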